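/- There is a universal constant C such that the following holds. Let α > 0 and L ≥ 0, let V : ℝ^d → ℝ be twice continuously differentiable and α-strongly convex, let W : ℝ^d → ℝ be L-Lipschitz, and let μ be the probability measure on ℝ^d with density proportional to e^{−V−W}. Then for every t > 0 the relative score x ↦ ∇log p_t(x) + x is Lipschitz with constant C·max(1, L²/α)/(1−e^{−2t}). (That is, the time-varying smoothness assumption holds with β̃₀ ≤ C·max(1, L²/α) for Lipschitz perturbations of strongly log-concave measures.) -/

import Mathlib

open MeasureTheory Real
open scoped RealInnerProductSpace ENNReal Classical

noncomputable section

/-- `Euc d` is Euclidean space `ℝ^d`. -/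
abbrev Euc (d : ℕ) := EuclideanSpace ℝ (Fin d)

/-- The standard Gaussian measure `N(0, I_d)` on `ℝ^d`. -/
def stdGaussian (d : ℕ) : Measure (Euc d) :=
  volume.withDensity fun x =>
    ENNReal.ofReal ((2 * π) ^ (-(d : ℝ) / 2) * Real.exp (-‖x‖ ^ 2 / 2))

/-- The density `p_t` of the Ornstein–Uhlenbeck flow of `μ` at time `t`. -/
def ouDensity (d : ℕ) (μ : Measure (Euc d)) (t : ℝ) (x : Euc d) : ℝ :=
  (2 * π * (1 - Real.exp (-2 * t))) ^ (-(d : ℝ) / 2) *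
    ∫ y, Real.exp (-‖x - Real.exp (-t) • y‖ ^ 2 / (2 * (1 - Real.exp (-2 * t)))) ∂μ

/-- The Ornstein–Uhlenbeck flow `μ_t` of `μ` at time `t`, i.e. the measure with
density `p_t` with respect to Lebesgue measure. -/
def ouFlow (d : ℕ) (μ : Measure (Euc d)) (t : ℝ) : Measure (Euc d) :=
  volume.withDensity fun x => ENNReal.ofReal (ouDensity d μ t x)

/-- The relative score `x ↦ ∇ log p_t(x) + x` of `μ_t`. -/
def relScore (d : ℕ) (μ : Measure (Euc d)) (t : ℝ) (x : Euc d) : Euc d :=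
  gradient (fun z => Real.log (ouDensity d μ t z)) x + x

/-- The relative Fisher information `FI(μ_t ‖ γ_d) = ∫ ‖∇ log p_t + x‖² dμ_t`. -/
def relFisher (d : ℕ) (μ : Measure (Euc d)) (t : ℝ) : ℝ :=
  ∫ x, ‖relScore d μ t x‖ ^ 2 ∂(ouFlow d μ t)

/-- Kullback–Leibler divergence `KL(ρ ‖ σ)`. -/
def KLdiv {α : Type*} [MeasurableSpace α] (ρ σ : Measure α) : ℝ≥0∞ :=
  if ρ ≪ σ then ENNReal.ofReal (∫ x, Real.log ((ρ.rnDeriv σ x).toReal) ∂ρ) else ⊤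

/-- The one-dimensional Brunn–Minkowski inequality for midpoints. -/
theorem volume_add_volume_le_of_midpoint_mem {A B S : Set ℝ} (hA : MeasurableSet A)
    (hB : MeasurableSet B) (hA' : A.Nonempty) (hB' : B.Nonempty)
    (h : ∀ a ∈ A, ∀ b ∈ B, (a + b) / 2 ∈ S) :
    volume A + volume B ≤ 2 * volume S := by
  have key : ∀ K : Set ℝ, K ⊆ A → IsCompact K → K.Nonempty → ∀ K' : Set ℝ, K' ⊆ B →
      IsCompact K' → K'.Nonempty → volume K + volume K' ≤ 2 * volume S := by
    intro K hKA hK hK0 K' hKB hK' hK0'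
    obtain ⟨a, haK, ha⟩ := hK.exists_isGreatest hK0
    obtain ⟨b, hbK, hb⟩ := hK'.exists_isLeast hK0'
    have e (c : ℝ) (T : Set ℝ) :
        volume ((fun x : ℝ => x * 2) ⁻¹' ((fun x => x + (-c)) ⁻¹' T)) = volume T / 2 := by
      rw [Real.volume_preimage_mul_right two_ne_zero, measure_preimage_add_right,
        abs_of_nonneg (by norm_num), mul_comm, ENNReal.div_eq_inv_mul,
        ENNReal.ofReal_inv_of_pos two_pos]
      norm_num [mul_comm]
    set K1 := (fun x : ℝ => x * 2) ⁻¹' ((fun x => x + (-b)) ⁻¹' K) with hK1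
    set K2 := (fun x : ℝ => x * 2) ⁻¹' ((fun x => x + (-a)) ⁻¹' K') with hK2
    have m2 : MeasurableSet K2 :=
      (measurable_id.mul_const 2) ((measurable_id.add_const (-a)) hK'.measurableSet)
    have hsub : K1 ∪ K2 ⊆ S := by
      rintro x (hx | hx)
      · have := h _ (hKA hx) _ (hKB hbK)
        convert this using 1; ring
      · have := h _ (hKA haK) _ (hKB hx)
        convert this using 1; ring
    have hint : volume (K1 ∩ K2) = 0 := by
      refine measure_mono_null (t := {(a + b) / 2}) ?_ (by simp)
      rintro x ⟨h1, h2⟩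
      have := ha h1
      have := hb h2
      simp only [Set.mem_singleton_iff]
      simp only at *
      linarith
    have h1 := measure_union_add_inter (μ := volume) K1 m2
    rw [hint, add_zero, hK1, hK2, e, e] at h1
    have h2 := measure_mono (μ := volume) hsub
    rw [h1, ← ENNReal.add_div] at h2
    rw [mul_comm]
    exact (ENNReal.div_le_iff two_ne_zero (by simp)).1 h2
  have key' : ∀ T : Set ℝ, MeasurableSet T → T.Nonempty → ∀ X : ℝ≥0∞, ∀ c : ℝ≥0∞,
      (∀ K ⊆ T, IsCompact K → K.Nonempty → volume K + c ≤ X) → volume T + c ≤ X := by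
    intro T hT hT0 X c H
    obtain ⟨p, hp⟩ := hT0
    have hc : c ≤ X := by
      simpa using H {p} (by simpa using hp) isCompact_singleton (by simp)
    rw [hT.measure_eq_iSup_isCompact, ENNReal.iSup_add]
    refine iSup_le fun K => ?_
    by_cases hKT : K ⊆ T
    · by_cases hK : IsCompact K
      · rcases K.eq_empty_or_nonempty with rfl | h0
        · simpa using hc
        · simpa [hKT, hK] using H K hKT hK h0
      · simpa [hK] using hc
    · simpa [hKT] using hc
  refine key' A hA hA' _ _ fun K h1 h2 h3 => ?_
  rw [add_comm]
  refine key' B hB hB' _ _ fun K' h1' h2' h3' => ?_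
  rw [add_comm]
  exact key K h1 h2 h3 K' h1' h2' h3'

/-- The midpoint Prékopa–Leindler property of a measure `m`. -/
def PrekopaLeindler {E : Type*} [AddCommGroup E] [Module ℝ E] [MeasurableSpace E]
    (m : Measure E) : Prop :=
  ∀ f g h : E → ℝ≥0∞, Measurable f → Measurable g → Measurable h →
    (∀ x y, g x * h y ≤ f ((2⁻¹ : ℝ) • (x + y)) ^ 2) →
    (∫⁻ x, g x ∂m) * (∫⁻ x, h x ∂m) ≤ (∫⁻ x, f x ∂m) ^ 2

theorem prekopaLeindler_real_of_iSup_eq_one {f g h : ℝ → ℝ≥0∞} (hf : Measurable f)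
    (hg : Measurable g) (hh : Measurable h) (hg1 : ⨆ x, g x = 1) (hh1 : ⨆ x, h x = 1)
    (H : ∀ x y, g x * h y ≤ f ((2⁻¹ : ℝ) • (x + y)) ^ 2) :
    (∫⁻ x, g x) * (∫⁻ x, h x) ≤ (∫⁻ x, f x) ^ 2 := by
  have hgle (x) : g x ≤ 1 := hg1 ▸ le_iSup g x
  have hhle (x) : h x ≤ 1 := hh1 ▸ le_iSup h x
  have layer (k : ℝ → ℝ≥0∞) (hk : Measurable k) (hk1 : ∀ x, k x ≤ 1) :
      ∫⁻ x, k x = ∫⁻ t in Set.Ioo (0 : ℝ) 1, volume {x | ENNReal.ofReal t < k x} := by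
    have e1 : ∀ x, k x = ENNReal.ofReal (k x).toReal := fun x =>
      (ENNReal.ofReal_toReal (ne_top_of_le_ne_top (by simp) (hk1 x))).symm
    have e2 (t : ℝ) (ht : 0 < t) : {x | ENNReal.ofReal t < k x} = {x | t < (k x).toReal} := by
      ext x
      simp only [Set.mem_ofPred_eq]
      rw [ENNReal.ofReal_lt_iff_lt_toReal ht.le (ne_top_of_le_ne_top (by simp) (hk1 x))]
    rw [lintegral_congr e1, lintegral_eq_lintegral_meas_lt _ (.of_forall fun x => by simp)
      hk.ennreal_toReal.aemeasurable]
    rw [← Set.Ioo_union_Ici_eq_Ioi (zero_lt_one' ℝ), lintegral_union measurableSet_Ici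
      (Set.disjoint_left.2 fun x hx hx' => not_lt.2 hx' hx.2)]
    have : ∫⁻ t in Set.Ici (1 : ℝ), volume {a | t < (k a).toReal} = 0 := by
      rw [setLIntegral_congr_fun (g := fun _ => 0) measurableSet_Ici]
      · simp
      · intro t ht
        have : {a | t < (k a).toReal} = ∅ := by
          ext a
          have := ENNReal.toReal_mono (by simp) (hk1 a)
          simp only [ENNReal.toReal_one] at this
          simp only [Set.mem_ofPred_eq, Set.mem_empty_iff_false, iff_false, not_lt]
          exact this.trans ht
        simp [this]
    rw [this, add_zero]
    exact setLIntegral_congr_fun measurableSet_Ioo fun t ht => by simp only [e2 t ht.1]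
  have hsum : (∫⁻ x, g x) + (∫⁻ x, h x) ≤ 2 * ∫⁻ x, f x := by
    have hfl : ∫⁻ x, min (f x) 1 ≤ ∫⁻ x, f x := lintegral_mono fun x => min_le_left _ _
    refine le_trans ?_ (mul_le_mul_right hfl 2)
    rw [layer g hg hgle, layer h hh hhle, layer _ (hf.min measurable_const)
      (fun x => min_le_right _ _), ← lintegral_const_mul' _ _ (by simp), ← lintegral_add_left']
    · refine setLIntegral_mono' measurableSet_Ioo fun t ht => ?_
      have ht1 : ENNReal.ofReal t < 1 := by simpa using ht.2
      refine volume_add_volume_le_of_midpoint_mem (measurableSet_lt measurable_const hg)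
        (measurableSet_lt measurable_const hh) ?_ ?_ fun a ha b hb => ?_
      · exact lt_iSup_iff.1 (hg1 ▸ ht1)
      · exact lt_iSup_iff.1 (hh1 ▸ ht1)
      · simp only [Set.mem_ofPred_eq] at ha hb ⊢
        refine lt_min ?_ ht1
        have h1 := ENNReal.mul_lt_mul ha hb
        have h2 := h1.trans_le (H a b)
        rw [← sq] at h2
        have h3 := lt_of_not_ge fun hle => not_lt.2 (pow_le_pow_left' hle 2) h2
        convert h3 using 2
        simp; ring
    · refine Measurable.aemeasurable ?_
      exact (Antitone.measurable fun s t hst => measure_mono fun x hx =>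
        lt_of_le_of_lt (ENNReal.ofReal_le_ofReal hst) hx)
  generalize (∫⁻ x, g x) = a at *
  generalize (∫⁻ x, h x) = b at *
  generalize (∫⁻ x, f x) = c at *
  by_cases hc : c = ⊤
  · simp [hc]
  have hab : a + b ≠ ⊤ := ne_top_of_le_ne_top (ENNReal.mul_ne_top (by simp) hc) hsum
  have ha : a ≠ ⊤ := fun h => hab (by simp [h])
  have hb : b ≠ ⊤ := fun h => hab (by simp [h])
  lift a to NNReal using ha
  lift b to NNReal using hb
  lift c to NNReal using hc
  norm_cast at *
  have : (a : ℝ) + b ≤ 2 * c := by exact_mod_cast hsum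
  have ha := a.2
  have hb := b.2
  have : (a : ℝ) * b ≤ c ^ 2 := by
    nlinarith [sq_nonneg ((a : ℝ) - b), a.coe_nonneg, b.coe_nonneg]
  exact_mod_cast this

theorem prekopaLeindler_real_of_bounded {f g h : ℝ → ℝ≥0∞} (hf : Measurable f)
    (hg : Measurable g) (hh : Measurable h) (hg1 : ⨆ x, g x ≠ ⊤) (hh1 : ⨆ x, h x ≠ ⊤)
    (H : ∀ x y, g x * h y ≤ f ((2⁻¹ : ℝ) • (x + y)) ^ 2) :
    (∫⁻ x, g x) * (∫⁻ x, h x) ≤ (∫⁻ x, f x) ^ 2 := by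
  set a := ⨆ x, g x with ha
  set b := ⨆ x, h x with hb
  by_cases ha0 : a = 0
  · have : ∀ x, g x = 0 := fun x => le_zero_iff.1 (ha0 ▸ le_iSup g x)
    simp [this]
  by_cases hb0 : b = 0
  · have : ∀ x, h x = 0 := fun x => le_zero_iff.1 (hb0 ▸ le_iSup h x)
    simp [this]
  set c : ℝ≥0∞ := (a * b) ^ (2⁻¹ : ℝ) with hc
  have hab0 : a * b ≠ 0 := mul_ne_zero ha0 hb0
  have habt : a * b ≠ ⊤ := ENNReal.mul_ne_top hg1 hh1
  have hcc : c ^ 2 = a * b := by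
    rw [hc, ← ENNReal.rpow_natCast, ← ENNReal.rpow_mul]; norm_num
  have := prekopaLeindler_real_of_iSup_eq_one (f := fun x => c⁻¹ * f x)
    (g := fun x => a⁻¹ * g x) (h := fun x => b⁻¹ * h x) (hf.const_mul _) (hg.const_mul _)
    (hh.const_mul _) (by rw [← ENNReal.mul_iSup, ENNReal.inv_mul_cancel ha0 hg1])
    (by rw [← ENNReal.mul_iSup, ENNReal.inv_mul_cancel hb0 hh1]) ?_
  · rw [lintegral_const_mul _ hf, lintegral_const_mul _ hg, lintegral_const_mul _ hh, mul_pow,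
      ← ENNReal.inv_pow, hcc, mul_mul_mul_comm, ← ENNReal.mul_inv (.inl ha0) (.inl hg1)] at this
    exact (ENNReal.mul_le_mul_iff_right (ENNReal.inv_ne_zero.2 habt)
      (ENNReal.inv_ne_top.2 hab0)).1 this
  · intro x y
    rw [mul_pow, ← ENNReal.inv_pow, hcc, mul_mul_mul_comm,
      ← ENNReal.mul_inv (.inl ha0) (.inl hg1)]
    exact mul_le_mul_right (H x y) _

theorem prekopaLeindler_real : PrekopaLeindler (volume : Measure ℝ) := by
  intro f g h hf hg hh H
  have trunc (k : ℝ → ℝ≥0∞) (hk : Measurable k) :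
      ∫⁻ x, k x = ⨆ n : ℕ, ∫⁻ x, min (k x) n := by
    rw [← lintegral_iSup (fun n => hk.min measurable_const)]
    · refine lintegral_congr fun x => ?_
      rw [← inf_iSup_eq, ENNReal.iSup_natCast, inf_top_eq]
    · intro n m hnm x
      exact min_le_min le_rfl (by exact_mod_cast hnm)
  rw [trunc g hg, trunc h hh, ENNReal.iSup_mul]
  refine iSup_le fun n => ?_
  rw [ENNReal.mul_iSup]
  refine iSup_le fun m => ?_
  refine prekopaLeindler_real_of_bounded hf (hg.min measurable_const) (hh.min measurable_const)
    (ne_top_of_le_ne_top (ENNReal.natCast_ne_top n) (iSup_le fun x => min_le_right _ _))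
    (ne_top_of_le_ne_top (ENNReal.natCast_ne_top m) (iSup_le fun x => min_le_right _ _)) ?_
  exact fun x y => (mul_le_mul' (min_le_left _ _) (min_le_left _ _)).trans (H x y)

theorem PrekopaLeindler.prod {E F : Type*} [AddCommGroup E] [Module ℝ E] [MeasurableSpace E]
    [AddCommGroup F] [Module ℝ F] [MeasurableSpace F] {m : Measure E} {n : Measure F}
    [SFinite m] [SFinite n] (hm : PrekopaLeindler m) (hn : PrekopaLeindler n) :
    PrekopaLeindler (m.prod n) := by
  intro f g h hf hg hh H
  rw [lintegral_prod _ hf.aemeasurable, lintegral_prod _ hg.aemeasurable,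
    lintegral_prod _ hh.aemeasurable]
  refine hm _ _ _ hf.lintegral_prod_right' hg.lintegral_prod_right' hh.lintegral_prod_right' ?_
  intro x y
  exact hn _ _ _ (hf.comp measurable_prodMk_left) (hg.comp measurable_prodMk_left)
    (hh.comp measurable_prodMk_left) fun z w => H (x, z) (y, w)

theorem PrekopaLeindler.of_measurePreserving {E F : Type*} [AddCommGroup E] [Module ℝ E]
    [MeasurableSpace E] [AddCommGroup F] [Module ℝ F] [MeasurableSpace F] {m : Measure E}
    {n : Measure F} (hm : PrekopaLeindler m) (e : E → F)
    (he : MeasurePreserving e m n) (hadd : ∀ x y, e ((2⁻¹ : ℝ) • (x + y)) = (2⁻¹ : ℝ) • (e x + e y)) :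
    PrekopaLeindler n := by
  intro f g h hf hg hh H
  rw [← he.lintegral_comp hf, ← he.lintegral_comp hg, ← he.lintegral_comp hh]
  refine hm _ _ _ (hf.comp he.measurable) (hg.comp he.measurable) (hh.comp he.measurable) ?_
  intro x y
  simpa only [Function.comp, hadd] using H (e x) (e y)

theorem prekopaLeindler_pi (n : ℕ) : PrekopaLeindler (volume : Measure (Fin n → ℝ)) := by
  induction n with
  | zero =>
    intro f g h hf hg hh H
    rw [volume_pi, Measure.pi_of_empty _ default, lintegral_dirac, lintegral_dirac, lintegral_dirac]
    convert H default default
  | succ n ih =>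
    refine (prekopaLeindler_real.prod ih).of_measurePreserving _
      (volume_preserving_piFinSuccAbove (fun _ => ℝ) 0).symm fun x y => ?_
    ext i
    refine Fin.cases ?_ (fun j => ?_) i <;> simp [MeasurableEquiv.piFinSuccAbove, mul_add]

theorem prekopaLeindler_euc (d : ℕ) : PrekopaLeindler (volume : Measure (Euc d)) :=
  (prekopaLeindler_pi d).of_measurePreserving _ (PiLp.volume_preserving_toLp (Fin d))
    fun x y => by ext i; simp [mul_add]

/-- The symmetrized Laplace transform bound obtained from Prékopa–Leindler. -/
theorem lintegral_exp_mul_lintegral_exp_neg_le {d : ℕ} {U : Euc d → ℝ} (hU : Measurable U)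
    {A L l : ℝ} (hA : 0 < A)
    (hmid : ∀ x y, U ((2⁻¹ : ℝ) • (x + y)) ≤
      (U x + U y) / 2 - A / 8 * ‖x - y‖ ^ 2 + L / 2 * ‖x - y‖)
    (hl : 0 ≤ l) {u : Euc d} (hu : ‖u‖ = 1) :
    (∫⁻ x, ENNReal.ofReal (exp (-U x)) * ENNReal.ofReal (exp (l * ⟪u, x⟫))) *
      (∫⁻ x, ENNReal.ofReal (exp (-U x)) * ENNReal.ofReal (exp (-(l * ⟪u, x⟫)))) ≤
    ENNReal.ofReal (exp ((L + l) ^ 2 / A)) * (∫⁻ x, ENNReal.ofReal (exp (-U x))) ^ 2 := by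
  have hin : Measurable fun x : Euc d => ⟪u, x⟫ := by fun_prop
  have := prekopaLeindler_euc d
    (fun x => ENNReal.ofReal (exp ((L + l) ^ 2 / (2 * A))) * ENNReal.ofReal (exp (-U x)))
    (fun x => ENNReal.ofReal (exp (-U x)) * ENNReal.ofReal (exp (l * ⟪u, x⟫)))
    (fun x => ENNReal.ofReal (exp (-U x)) * ENNReal.ofReal (exp (-(l * ⟪u, x⟫))))
    (by fun_prop) (by fun_prop) (by fun_prop) ?_
  · rw [lintegral_const_mul' _ _ (by simp), mul_pow, ← ENNReal.ofReal_pow (exp_nonneg _),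
      ← exp_nat_mul] at this
    convert this using 4
    push_cast; field_simp
  · intro x y
    simp only [← ENNReal.ofReal_mul (exp_nonneg _), ← exp_add,
      ← ENNReal.ofReal_pow (exp_nonneg _), ← exp_nat_mul]
    refine ENNReal.ofReal_le_ofReal (exp_le_exp.2 ?_)
    have h1 := hmid x y
    have h2 : ⟪u, x⟫ - ⟪u, y⟫ ≤ ‖x - y‖ := by
      rw [← inner_sub_right]
      simpa [hu] using real_inner_le_norm u (x - y)
    have h3 := mul_le_mul_of_nonneg_left h2 hl
    set r := ‖x - y‖
    have h4 : (L + l) * r - A / 4 * r ^ 2 ≤ (L + l) ^ 2 / A := by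
      rw [le_div_iff₀ hA]
      nlinarith [sq_nonneg (A * r / 2 - (L + l))]
    have h5 : 2 * ((L + l) ^ 2 / (2 * A)) = (L + l) ^ 2 / A := by field_simp
    push_cast
    rw [mul_add, h5]
    linarith

theorem sq_le_add_exp_add_exp {l R D : ℝ} (hl : 0 < l) (hR : 0 ≤ R) :
    D ^ 2 ≤ 2 * R ^ 2 + 4 / l ^ 2 * exp (-(l * R)) * (exp (l * D) + exp (-(l * D))) := by
  have h1 : exp (l * |D|) ≤ exp (l * D) + exp (-(l * D)) := by
    rcases abs_choice D with h | h <;> rw [h]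
    · linarith [exp_pos (-(l * D))]
    · rw [mul_neg]; linarith [exp_pos (l * D)]
  have h2 : D ^ 2 ≤ 2 * R ^ 2 + 4 / l ^ 2 * exp (l * (|D| - R)) := by
    rw [← sq_abs]
    have hD := abs_nonneg D
    set D' := |D|
    rcases le_total D' R with h | h
    · have : 0 ≤ 4 / l ^ 2 * exp (l * (D' - R)) := by positivity
      nlinarith
    · have h3 := quadratic_le_exp_of_nonneg (mul_nonneg hl.le (sub_nonneg.2 h))
      have h4 : (l * (D' - R)) ^ 2 / 2 ≤ exp (l * (D' - R)) := by
        nlinarith [mul_nonneg hl.le (sub_nonneg.2 h)]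
      have h5 : 4 / l ^ 2 * ((l * (D' - R)) ^ 2 / 2) ≤ 4 / l ^ 2 * exp (l * (D' - R)) := by gcongr
      have h6 : 4 / l ^ 2 * ((l * (D' - R)) ^ 2 / 2) = 2 * (D' - R) ^ 2 := by field_simp; ring
      nlinarith [sq_nonneg (D' - 2 * R)]
  refine h2.trans ?_
  rw [mul_sub, sub_eq_neg_add, exp_add, ← mul_assoc]
  gcongr

theorem variance_le_lintegral_lintegral_sq_sub {Ω : Type*} [MeasurableSpace Ω] {q : Measure Ω}
    [IsProbabilityMeasure q] {X : Ω → ℝ} (hX : MemLp X 2 q) :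
    ENNReal.ofReal (ProbabilityTheory.variance X q) ≤
      ∫⁻ x, ∫⁻ y, ENNReal.ofReal ((X x - X y) ^ 2) ∂q ∂q := by
  have h : ∀ x, ENNReal.ofReal (ProbabilityTheory.variance X q) ≤
      ∫⁻ y, ENNReal.ofReal ((X x - X y) ^ 2) ∂q := by
    intro x
    have hm : MemLp (fun y => X x - X y) 2 q := (memLp_const (X x)).sub hX
    rw [← ofReal_integral_eq_lintegral_ofReal hm.integrable_sq
      (.of_forall fun y => sq_nonneg _)]
    refine ENNReal.ofReal_le_ofReal ?_
    rw [← ProbabilityTheory.variance_const_sub hX.1 (X x)]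
    exact ProbabilityTheory.variance_le_expectation_sq hm.1
  calc _ = ∫⁻ x, ENNReal.ofReal (ProbabilityTheory.variance X q) ∂q := by simp
    _ ≤ _ := lintegral_mono h

/-- A dimension-free variance bound for Lipschitz perturbations of strongly log-concave measures. -/
theorem variance_inner_tilted_le {d : ℕ} {U : Euc d → ℝ} (hU : Measurable U)
    (hint : Integrable fun x => exp (-U x)) {A L : ℝ} (hA : 0 < A)
    (hmid : ∀ x y, U ((2⁻¹ : ℝ) • (x + y)) ≤
      (U x + U y) / 2 - A / 8 * ‖x - y‖ ^ 2 + L / 2 * ‖x - y‖)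
    {u : Euc d} (hu : ‖u‖ = 1)
    (hmem : MemLp (fun x => ⟪u, x⟫) 2 (volume.tilted fun x => -U x)) :
    ProbabilityTheory.variance (fun x => ⟪u, x⟫) (volume.tilted fun x => -U x) ≤
      40 / A + 32 * L ^ 2 / A ^ 2 := by
  have hprob := isProbabilityMeasure_tilted hint
  set q := volume.tilted fun x => -U x with hq
  set l := √(L ^ 2 + A) with hl
  have hll : l ^ 2 = L ^ 2 + A := Real.sq_sqrt (by positivity)
  have hlpos : 0 < l := Real.sqrt_pos.2 (by positivity)
  have hLl : L ≤ l := Real.le_sqrt_of_sq_le (by linarith)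
  set R := 4 * l / A with hR
  have hin : Measurable fun x : Euc d => ⟪u, x⟫ := by fun_prop
  have hZ : 0 < ∫ x, exp (-U x) := integral_exp_pos hint
  have htilt (g : Euc d → ℝ≥0∞) : ∫⁻ x, g x ∂q =
      ENNReal.ofReal (∫ x, exp (-U x))⁻¹ * ∫⁻ x, ENNReal.ofReal (exp (-U x)) * g x := by
    rw [hq, lintegral_tilted, ← lintegral_const_mul' _ _ (by simp)]
    refine lintegral_congr fun x => ?_
    rw [div_eq_inv_mul, ENNReal.ofReal_mul (inv_nonneg.2 hZ.le), mul_assoc]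
  have hlap : (∫⁻ x, ENNReal.ofReal (exp (l * ⟪u, x⟫)) ∂q) *
      (∫⁻ x, ENNReal.ofReal (exp (-(l * ⟪u, x⟫))) ∂q) ≤ ENNReal.ofReal (exp (l * R)) := by
    rw [htilt, htilt, mul_mul_mul_comm]
    refine (mul_le_mul_right
      (lintegral_exp_mul_lintegral_exp_neg_le hU hA hmid hlpos.le hu) _).trans ?_
    rw [← ofReal_integral_eq_lintegral_ofReal hint (.of_forall fun x => exp_nonneg _),
      ← ENNReal.ofReal_pow hZ.le, ← ENNReal.ofReal_mul (by positivity),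
      ← ENNReal.ofReal_mul (by positivity), ← ENNReal.ofReal_mul (by positivity)]
    refine ENNReal.ofReal_le_ofReal ?_
    have : (∫ x, exp (-U x))⁻¹ * (∫ x, exp (-U x))⁻¹ *
      (exp ((L + l) ^ 2 / A) * (∫ x, exp (-U x)) ^ 2) = exp ((L + l) ^ 2 / A) := by
      field_simp
    rw [this, exp_le_exp, hR, mul_div_assoc', div_le_div_iff_of_pos_right hA]
    nlinarith
  have hmeas1 : Measurable fun x : Euc d => ENNReal.ofReal (exp (l * ⟪u, x⟫)) := by fun_prop
  have hmeas2 : Measurable fun x : Euc d => ENNReal.ofReal (exp (-(l * ⟪u, x⟫))) := by fun_prop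
  have hpt (x y : Euc d) : ENNReal.ofReal ((⟪u, x⟫ - ⟪u, y⟫) ^ 2) ≤
      ENNReal.ofReal (2 * R ^ 2) + ENNReal.ofReal (4 / l ^ 2 * exp (-(l * R))) *
        (ENNReal.ofReal (exp (l * ⟪u, x⟫)) * ENNReal.ofReal (exp (-(l * ⟪u, y⟫))) +
          ENNReal.ofReal (exp (-(l * ⟪u, x⟫))) * ENNReal.ofReal (exp (l * ⟪u, y⟫))) := by
    rw [← ENNReal.ofReal_mul (exp_nonneg _), ← ENNReal.ofReal_mul (exp_nonneg _),
      ← ENNReal.ofReal_add (by positivity) (by positivity), ← ENNReal.ofReal_mul (by positivity),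
      ← ENNReal.ofReal_add (by positivity) (by positivity), ← exp_add, ← exp_add]
    refine ENNReal.ofReal_le_ofReal ?_
    convert sq_le_add_exp_add_exp (D := ⟪u, x⟫ - ⟪u, y⟫) hlpos (R := R) (by positivity) using 5
      <;> ring_nf
  have hdouble := (variance_le_lintegral_lintegral_sq_sub hmem).trans
    (lintegral_mono fun x => lintegral_mono fun y => hpt x y)
  have hcalc : ∫⁻ x, ∫⁻ y, (ENNReal.ofReal (2 * R ^ 2) +
      ENNReal.ofReal (4 / l ^ 2 * exp (-(l * R))) *
        (ENNReal.ofReal (exp (l * ⟪u, x⟫)) * ENNReal.ofReal (exp (-(l * ⟪u, y⟫))) +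
          ENNReal.ofReal (exp (-(l * ⟪u, x⟫))) * ENNReal.ofReal (exp (l * ⟪u, y⟫)))) ∂q ∂q =
      ENNReal.ofReal (2 * R ^ 2) + ENNReal.ofReal (4 / l ^ 2 * exp (-(l * R))) *
        (2 * ((∫⁻ x, ENNReal.ofReal (exp (l * ⟪u, x⟫)) ∂q) *
          (∫⁻ x, ENNReal.ofReal (exp (-(l * ⟪u, x⟫))) ∂q))) := by
    have inner (x : Euc d) : ∫⁻ y, (ENNReal.ofReal (2 * R ^ 2) +
      ENNReal.ofReal (4 / l ^ 2 * exp (-(l * R))) *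
        (ENNReal.ofReal (exp (l * ⟪u, x⟫)) * ENNReal.ofReal (exp (-(l * ⟪u, y⟫))) +
          ENNReal.ofReal (exp (-(l * ⟪u, x⟫))) * ENNReal.ofReal (exp (l * ⟪u, y⟫)))) ∂q =
        ENNReal.ofReal (2 * R ^ 2) + ENNReal.ofReal (4 / l ^ 2 * exp (-(l * R))) *
        (ENNReal.ofReal (exp (l * ⟪u, x⟫)) * ∫⁻ y, ENNReal.ofReal (exp (-(l * ⟪u, y⟫))) ∂q +
          ENNReal.ofReal (exp (-(l * ⟪u, x⟫))) *
            ∫⁻ y, ENNReal.ofReal (exp (l * ⟪u, y⟫)) ∂q) := by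
      rw [lintegral_add_left measurable_const, lintegral_const_mul' _ _ (by simp),
        lintegral_add_left (hmeas2.const_mul _), lintegral_const_mul' _ _ (by simp),
        lintegral_const_mul' _ _ (by simp)]
      simp
    simp_rw [inner]
    rw [lintegral_add_left measurable_const, lintegral_const_mul' _ _ (by simp),
      lintegral_add_left (hmeas1.mul_const _), lintegral_mul_const _ hmeas1,
      lintegral_mul_const _ hmeas2]
    simp only [lintegral_const, measure_univ, mul_one]
    ring
  rw [hcalc] at hdouble
  have hfin := hdouble.trans (add_le_add le_rfl (mul_le_mul_right (mul_le_mul_right hlap 2) _))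
  have h2 (c : ℝ) : 2 * ENNReal.ofReal c = ENNReal.ofReal (2 * c) := by
    rw [ENNReal.ofReal_mul two_pos.le]; simp
  rw [h2,
    ← ENNReal.ofReal_mul (by positivity), ← ENNReal.ofReal_add (by positivity) (by positivity),
    ENNReal.ofReal_le_ofReal_iff (by positivity)] at hfin
  refine hfin.trans ?_
  have e1 : 4 / l ^ 2 * exp (-(l * R)) * (2 * exp (l * R)) = 8 / l ^ 2 := by
    rw [exp_neg]; field_simp; norm_num
  have e2 : 8 / l ^ 2 ≤ 8 / A := by
    rw [hll]; gcongr; nlinarith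
  have e3 : 2 * R ^ 2 = 32 * L ^ 2 / A ^ 2 + 32 / A := by
    rw [hR, div_pow, mul_pow, hll]; field_simp; ring
  rw [e1, e3]
  have : 40 / A = 32 / A + 8 / A := by ring
  linarith

section StrongConvexity

variable {E : Type*} [NormedAddCommGroup E] [InnerProductSpace ℝ E] [CompleteSpace E]
  {V : E → ℝ} {α : ℝ}

theorem differentiable_gradient (hV : ContDiff ℝ 2 V) :
    Differentiable ℝ fun z => gradient V z := by
  have : Differentiable ℝ (fderiv ℝ V) :=
    (hV.fderiv_right (m := 1) (by norm_num)).differentiable (by norm_num)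
  exact (InnerProductSpace.toDual ℝ E).symm.toContinuousLinearEquiv.differentiable.comp this

theorem hasDerivAt_comp_line (hV : ContDiff ℝ 2 V) (x h : E) (τ : ℝ) :
    HasDerivAt (fun τ : ℝ => V (x + τ • h)) ⟪gradient V (x + τ • h), h⟫ τ := by
  have h1 : HasDerivAt (fun τ : ℝ => x + τ • h) h τ := by
    simpa using ((hasDerivAt_id τ).smul_const h).const_add x
  have h2 := ((hV.differentiable (by norm_num)).differentiableAt
    (x := x + τ • h)).hasGradientAt.hasFDerivAt
  exact (h2.comp_hasDerivAt τ h1).congr_deriv (by simp)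

theorem convexOn_line_sub_sq (hV : ContDiff ℝ 2 V)
    (hα : ∀ x u : E, α * ‖u‖ ^ 2 ≤ ⟪(fderiv ℝ (fun z => gradient V z) x) u, u⟫) (x h : E) :
    ConvexOn ℝ Set.univ fun τ : ℝ => V (x + τ • h) - α / 2 * ‖h‖ ^ 2 * τ ^ 2 := by
  have d1 (τ : ℝ) : HasDerivAt (fun τ : ℝ => V (x + τ • h) - α / 2 * ‖h‖ ^ 2 * τ ^ 2)
      (⟪gradient V (x + τ • h), h⟫ - α * ‖h‖ ^ 2 * τ) τ := by
    exact ((hasDerivAt_comp_line hV x h τ).sub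
      ((hasDerivAt_pow 2 τ).const_mul (α / 2 * ‖h‖ ^ 2))).congr_deriv (by norm_num; ring)
  have d2 (τ : ℝ) : HasDerivAt (fun τ : ℝ => ⟪gradient V (x + τ • h), h⟫ - α * ‖h‖ ^ 2 * τ)
      (⟪(fderiv ℝ (fun z => gradient V z) (x + τ • h)) h, h⟫ - α * ‖h‖ ^ 2) τ := by
    have h1 : HasDerivAt (fun τ : ℝ => x + τ • h) h τ := by
      simpa using ((hasDerivAt_id τ).smul_const h).const_add x
    have h2 := ((differentiable_gradient hV) (x + τ • h)).hasFDerivAt.comp_hasDerivAt τ h1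
    have h3 := h2.inner ℝ (hasDerivAt_const τ h)
    exact (h3.sub ((hasDerivAt_id τ).const_mul (α * ‖h‖ ^ 2))).congr_deriv (by simp)
  refine convexOn_of_hasDerivWithinAt2_nonneg convex_univ
    (fun τ _ => (d1 τ).continuousAt.continuousWithinAt)
    (fun τ _ => (d1 τ).hasDerivWithinAt) (fun τ _ => (d2 τ).hasDerivWithinAt) fun τ _ => ?_
  exact sub_nonneg.2 (hα _ _)

theorem midpoint_le_of_hessian (hV : ContDiff ℝ 2 V)
    (hα : ∀ x u : E, α * ‖u‖ ^ 2 ≤ ⟪(fderiv ℝ (fun z => gradient V z) x) u, u⟫) (x y : E) :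
    V ((2⁻¹ : ℝ) • (x + y)) ≤ (V x + V y) / 2 - α / 8 * ‖x - y‖ ^ 2 := by
  have h := (convexOn_line_sub_sq hV hα x (y - x)).2 (Set.mem_univ 0) (Set.mem_univ 1)
    (show (0 : ℝ) ≤ 2⁻¹ by norm_num) (show (0 : ℝ) ≤ 2⁻¹ by norm_num) (by norm_num)
  have e : x + (2⁻¹ : ℝ) • (y - x) = (2⁻¹ : ℝ) • (x + y) := by module
  simp only [smul_eq_mul, mul_zero, mul_one, zero_add, e, zero_smul, add_zero, one_smul,
    add_sub_cancel] at h
  rw [norm_sub_rev]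
  linarith

theorem add_inner_gradient_add_sq_le (hV : ContDiff ℝ 2 V)
    (hα : ∀ x u : E, α * ‖u‖ ^ 2 ≤ ⟪(fderiv ℝ (fun z => gradient V z) x) u, u⟫) (x h : E) :
    V x + ⟪gradient V x, h⟫ + α / 2 * ‖h‖ ^ 2 ≤ V (x + h) := by
  have d : HasDerivAt (fun τ : ℝ => V (x + τ • h) - α / 2 * ‖h‖ ^ 2 * τ ^ 2)
      ⟪gradient V x, h⟫ 0 := by
    exact ((hasDerivAt_comp_line hV x h 0).sub
      ((hasDerivAt_pow 2 0).const_mul (α / 2 * ‖h‖ ^ 2))).congr_deriv (by simp)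
  have := (convexOn_line_sub_sq hV hα x h).le_slope_of_hasDerivWithinAt_Ioi (Set.mem_univ 0)
    (Set.mem_univ 1) one_pos d.hasDerivWithinAt
  simp only [slope_def_field, one_smul, zero_smul, add_zero] at this
  linarith

theorem integrable_exp_neg_add [FiniteDimensional ℝ E] [MeasurableSpace E] [BorelSpace E]
    {W : E → ℝ} {L : ℝ} (hα0 : 0 < α) (hV : ContDiff ℝ 2 V)
    (hα : ∀ x u : E, α * ‖u‖ ^ 2 ≤ ⟪(fderiv ℝ (fun z => gradient V z) x) u, u⟫)
    (hW : ∀ x y, |W x - W y| ≤ L * ‖x - y‖) (hWm : Measurable W) :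
    Integrable fun x => exp (-(V x + W x)) := by
  have hg : Integrable fun x : E => exp (-(α / 4) * ‖x‖ ^ 2) := by
    have := (GaussianFourier.integrable_cexp_neg_mul_sq_norm_add (V := E)
      (b := ((α / 4 : ℝ) : ℂ)) (by simpa using hα0) 0 0).norm
    refine this.congr (.of_forall fun x => ?_)
    simp only [Complex.norm_exp]
    congr 1
    norm_cast
    simp
  set b := ‖gradient V 0‖ + L with hb
  refine (hg.const_mul (exp (-(V 0 + W 0) + b ^ 2 / α))).mono'
    ((hV.continuous.measurable.add hWm).neg.exp.aestronglyMeasurable) (.of_forall fun x => ?_)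
  rw [Real.norm_eq_abs, abs_exp, ← exp_add, exp_le_exp]
  have h1 := add_inner_gradient_add_sq_le hV hα 0 x
  have h2 := (abs_le.1 (hW x 0)).1
  have h3 := (abs_le.1 (abs_real_inner_le_norm (gradient V 0) x)).1
  rw [zero_add] at h1
  rw [sub_zero] at h2
  have h4 : b * ‖x‖ ≤ α / 4 * ‖x‖ ^ 2 + b ^ 2 / α := by
    have : b * ‖x‖ = α / 4 * ‖x‖ ^ 2 + b ^ 2 / α - α / 4 * (‖x‖ - 2 * b / α) ^ 2 := by
      field_simp; ring
    rw [this]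
    have : 0 ≤ α / 4 * (‖x‖ - 2 * b / α) ^ 2 := by positivity
    linarith
  rw [hb, add_mul] at h4
  rw [hb]
  linarith

end StrongConvexity

theorem abs_covariance_le_of_variance_le {Ω : Type*} [MeasurableSpace Ω] {q : Measure Ω}
    [IsFiniteMeasure q] {X Y : Ω → ℝ} (hX : MemLp X 2 q) (hY : MemLp Y 2 q) {K : ℝ}
    (hXK : ProbabilityTheory.variance X q ≤ K) (hYK : ProbabilityTheory.variance Y q ≤ K) :
    |ProbabilityTheory.covariance X Y q| ≤ K := by
  have h1 := ProbabilityTheory.variance_add hX hY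
  have h2 := ProbabilityTheory.variance_sub hX hY
  have h3 := ProbabilityTheory.variance_nonneg (X + Y) q
  have h4 := ProbabilityTheory.variance_nonneg (X - Y) q
  exact abs_le.2 ⟨by linarith, by linarith⟩

theorem abs_covariance_inner_le {E : Type*} [NormedAddCommGroup E] [InnerProductSpace ℝ E]
    [MeasurableSpace E] {q : Measure E} [IsFiniteMeasure q] {K : ℝ}
    (hmem : ∀ u : E, MemLp (fun x => ⟪u, x⟫) 2 q)
    (hK : ∀ u : E, ‖u‖ = 1 → ProbabilityTheory.variance (fun x => ⟪u, x⟫) q ≤ K) (w h : E) :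
    |ProbabilityTheory.covariance (fun x => ⟪w, x⟫) (fun x => ⟪h, x⟫) q| ≤ K * ‖w‖ * ‖h‖ := by
  rcases eq_or_ne w 0 with rfl | hw
  · simp [ProbabilityTheory.covariance]
  rcases eq_or_ne h 0 with rfl | hh
  · simp [ProbabilityTheory.covariance]
  have e (v : E) (hv : v ≠ 0) : (fun x => ⟪v, x⟫) = fun x => ‖v‖ * ⟪‖v‖⁻¹ • v, x⟫ := by
    ext x
    rw [real_inner_smul_left, ← mul_assoc, mul_inv_cancel₀ (norm_ne_zero_iff.2 hv), one_mul]
  have n (v : E) (hv : v ≠ 0) : ‖‖v‖⁻¹ • v‖ = 1 := by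
    rw [norm_smul, norm_inv, norm_norm, inv_mul_cancel₀ (norm_ne_zero_iff.2 hv)]
  rw [e w hw, e h hh, ProbabilityTheory.covariance_const_mul_left,
    ProbabilityTheory.covariance_const_mul_right, abs_mul, abs_mul, abs_norm, abs_norm]
  have := abs_covariance_le_of_variance_le (hmem (‖w‖⁻¹ • w)) (hmem (‖h‖⁻¹ • h))
    (hK _ (n w hw)) (hK _ (n h hh))
  calc _ ≤ ‖w‖ * (‖h‖ * K) := by gcongr
    _ = _ := by ring

section GaussianKernel

variable {E : Type*} [NormedAddCommGroup E] {v : ℝ}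

/-- The unnormalized Gaussian kernel of variance `v`. -/
def gaussKernel (v : ℝ) (z : E) : ℝ := exp (-‖z‖ ^ 2 / (2 * v))

theorem continuous_gaussKernel : Continuous (gaussKernel v : E → ℝ) := by
  unfold gaussKernel; fun_prop

theorem gaussKernel_nonneg (z : E) : 0 ≤ gaussKernel v z := exp_nonneg _

theorem gaussKernel_le_one (hv : 0 < v) (z : E) : gaussKernel v z ≤ 1 := by
  refine exp_le_one_iff.2 ?_
  rw [neg_div]
  exact neg_nonpos.2 (by positivity)

theorem norm_sq_mul_gaussKernel_le (hv : 0 < v) (z : E) :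
    ‖z‖ ^ 2 * gaussKernel v z ≤ 2 * v := by
  have h := add_one_le_exp (‖z‖ ^ 2 / (2 * v))
  have h2 : exp (‖z‖ ^ 2 / (2 * v)) * gaussKernel v z = 1 := by
    rw [gaussKernel, ← exp_add, neg_div, add_neg_cancel, exp_zero]
  have h3 : ‖z‖ ^ 2 / (2 * v) * gaussKernel v z ≤ 1 := by
    rw [← h2]
    exact mul_le_mul_of_nonneg_right (by linarith) (gaussKernel_nonneg z)
  have h4 : ‖z‖ ^ 2 * gaussKernel v z = 2 * v * (‖z‖ ^ 2 / (2 * v) * gaussKernel v z) := by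
    field_simp
  rw [h4]
  nlinarith

theorem norm_mul_gaussKernel_le (hv : 0 < v) (z : E) : ‖z‖ * gaussKernel v z ≤ 1 + 2 * v := by
  have h1 := norm_sq_mul_gaussKernel_le hv z
  have h2 := gaussKernel_le_one hv z
  have h3 := gaussKernel_nonneg (v := v) z
  nlinarith [mul_nonneg (sq_nonneg (‖z‖ - 1)) h3]

theorem norm_gaussKernel_le (hv : 0 < v) (z : E) : ‖gaussKernel v z‖ ≤ 1 := by
  rw [Real.norm_of_nonneg (gaussKernel_nonneg z)]; exact gaussKernel_le_one hv z

variable [InnerProductSpace ℝ E]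

/-- The derivative of `gaussKernel v`. -/
def gaussKernelDeriv (v : ℝ) (z : E) : E →L[ℝ] ℝ := -(gaussKernel v z / v) • innerSL ℝ z

/-- The derivative of `z ↦ ⟪w, z⟫ * gaussKernel v z`. -/
def innerGaussKernelDeriv (v : ℝ) (w z : E) : E →L[ℝ] ℝ :=
  ⟪w, z⟫ • gaussKernelDeriv v z + gaussKernel v z • innerSL ℝ w

theorem continuous_gaussKernelDeriv : Continuous (gaussKernelDeriv v : E → E →L[ℝ] ℝ) := by
  have := continuous_gaussKernel (E := E) (v := v)
  unfold gaussKernelDeriv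
  fun_prop

theorem continuous_innerGaussKernelDeriv (w : E) :
    Continuous (innerGaussKernelDeriv v w : E → E →L[ℝ] ℝ) := by
  have := continuous_gaussKernel (E := E) (v := v)
  have := continuous_gaussKernelDeriv (E := E) (v := v)
  unfold innerGaussKernelDeriv
  fun_prop

theorem norm_gaussKernelDeriv_le (hv : 0 < v) (z : E) :
    ‖gaussKernelDeriv v z‖ ≤ (1 + 2 * v) / v := by
  rw [gaussKernelDeriv, norm_smul, innerSL_apply_norm, norm_neg, norm_div,
    Real.norm_of_nonneg (gaussKernel_nonneg z), Real.norm_of_nonneg hv.le, div_mul_eq_mul_div,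
    mul_comm]
  gcongr
  exact norm_mul_gaussKernel_le hv z

theorem norm_inner_mul_gaussKernel_le (hv : 0 < v) (w z : E) :
    ‖⟪w, z⟫ * gaussKernel v z‖ ≤ ‖w‖ * (1 + 2 * v) := by
  rw [norm_mul, Real.norm_of_nonneg (gaussKernel_nonneg z)]
  calc _ ≤ (‖w‖ * ‖z‖) * gaussKernel v z :=
        mul_le_mul_of_nonneg_right (norm_inner_le_norm _ _) (gaussKernel_nonneg z)
    _ = ‖w‖ * (‖z‖ * gaussKernel v z) := by ring
    _ ≤ _ := mul_le_mul_of_nonneg_left (norm_mul_gaussKernel_le hv z) (norm_nonneg _)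

theorem norm_innerGaussKernelDeriv_le (hv : 0 < v) (w z : E) :
    ‖innerGaussKernelDeriv v w z‖ ≤ 3 * ‖w‖ := by
  rw [innerGaussKernelDeriv]
  have h1 : ‖⟪w, z⟫ • gaussKernelDeriv v z‖ ≤ 2 * ‖w‖ := by
    rw [gaussKernelDeriv, norm_smul, norm_smul, innerSL_apply_norm, norm_neg, norm_div,
      Real.norm_of_nonneg (gaussKernel_nonneg z), Real.norm_of_nonneg hv.le]
    calc _ ≤ (‖w‖ * ‖z‖) * (gaussKernel v z / v * ‖z‖) :=
          mul_le_mul_of_nonneg_right (norm_inner_le_norm _ _)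
            (mul_nonneg (div_nonneg (gaussKernel_nonneg z) hv.le) (norm_nonneg _))
      _ = ‖w‖ * ((‖z‖ ^ 2 * gaussKernel v z) / v) := by ring
      _ ≤ ‖w‖ * (2 * v / v) := mul_le_mul_of_nonneg_left
          (div_le_div_of_nonneg_right (norm_sq_mul_gaussKernel_le hv z) hv.le) (norm_nonneg _)
      _ = _ := by field_simp
  have h2 : ‖gaussKernel v z • innerSL ℝ w‖ ≤ ‖w‖ := by
    rw [norm_smul, innerSL_apply_norm]
    exact mul_le_of_le_one_left (norm_nonneg _) (norm_gaussKernel_le hv z)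
  linarith [norm_add_le (⟪w, z⟫ • gaussKernelDeriv v z) (gaussKernel v z • innerSL ℝ w)]

theorem hasFDerivAt_gaussKernel (z : E) :
    HasFDerivAt (gaussKernel v) (gaussKernelDeriv v z) z := by
  have h := (((hasStrictFDerivAt_norm_sq z).hasFDerivAt.neg).mul_const (2 * v)⁻¹).exp
  refine (h.congr_fderiv ?_).congr_of_eventuallyEq (.of_forall fun y => ?_)
  · ext u
    simp [gaussKernelDeriv, gaussKernel, div_eq_mul_inv]
    ring
  · simp [gaussKernel, div_eq_mul_inv]

theorem hasFDerivAt_inner_mul_gaussKernel (w z : E) :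
    HasFDerivAt (fun z => ⟪w, z⟫ * gaussKernel v z) (innerGaussKernelDeriv v w z) z :=
  ((innerSL ℝ w).hasFDerivAt (x := z)).mul (hasFDerivAt_gaussKernel z)

variable [MeasurableSpace E] [BorelSpace E]

theorem integrable_comp_sub_smul {F : Type*} [NormedAddCommGroup F] [SecondCountableTopology F]
    {μ : Measure E} [IsFiniteMeasure μ] {Φ : E → F} (hΦ : Continuous Φ) {B : ℝ}
    (hB : ∀ z, ‖Φ z‖ ≤ B) (x : E) (s : ℝ) : Integrable (fun y => Φ (x - s • y)) μ :=
  Integrable.of_bound (hΦ.comp (by fun_prop)).aestronglyMeasurable B (.of_forall fun _ => hB _)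

theorem hasFDerivAt_integral_comp_sub_smul [FiniteDimensional ℝ E] {μ : Measure E}
    [IsFiniteMeasure μ] {Φ : E → ℝ}
    {Φ' : E → E →L[ℝ] ℝ} (hΦ : ∀ z, HasFDerivAt Φ (Φ' z) z) (hΦ' : Continuous Φ') {B B' : ℝ}
    (hB : ∀ z, ‖Φ z‖ ≤ B) (hB' : ∀ z, ‖Φ' z‖ ≤ B') (x : E) (s : ℝ) :
    HasFDerivAt (fun x => ∫ y, Φ (x - s • y) ∂μ) (∫ y, Φ' (x - s • y) ∂μ) x := by
  have hc : Continuous Φ := continuous_iff_continuousAt.2 fun z => (hΦ z).continuousAt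
  refine hasFDerivAt_integral_of_dominated_of_fderiv_le (bound := fun _ => B')
    (F' := fun x y => Φ' (x - s • y)) Filter.univ_mem
    (.of_forall fun x => (integrable_comp_sub_smul hc hB x s).1)
    (integrable_comp_sub_smul hc hB x s) ?_ (.of_forall fun y x _ => hB' _)
    (integrable_const _) (.of_forall fun y x _ => ?_)
  · exact (hΦ'.comp (by fun_prop)).aestronglyMeasurable
  · exact (hΦ _).comp x ((hasFDerivAt_id x).sub_const _)

end GaussianKernel

section Posterior

variable {E : Type*} [NormedAddCommGroup E] [InnerProductSpace ℝ E] [MeasurableSpace E]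
  {μ : Measure E} {v : ℝ}

/-- The convolution of the image of `μ` under `y ↦ s • y` with the Gaussian kernel. -/
def gaussConv (μ : Measure E) (s v : ℝ) (x : E) : ℝ := ∫ y, gaussKernel v (x - s • y) ∂μ

/-- The conditional law of `y` given the observation `x = s • y + √v • noise`. -/
def posterior (μ : Measure E) (s v : ℝ) (x : E) : Measure E :=
  μ.tilted fun y => -‖x - s • y‖ ^ 2 / (2 * v)

theorem integral_posterior (s : ℝ) (x : E) (g : E → ℝ) :
    ∫ y, g y ∂(posterior μ s v x) =
      (∫ y, g y * gaussKernel v (x - s • y) ∂μ) / gaussConv μ s v x := by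
  rw [posterior, integral_tilted, ← integral_div]
  refine integral_congr_ae (.of_forall fun y => ?_)
  simp only [smul_eq_mul, gaussConv, gaussKernel]
  ring

variable [BorelSpace E] [IsProbabilityMeasure μ]

theorem integrable_gaussKernel (hv : 0 < v) (x : E) (s : ℝ) :
    Integrable (fun y => gaussKernel v (x - s • y)) μ :=
  integrable_comp_sub_smul continuous_gaussKernel (norm_gaussKernel_le hv) x s

theorem gaussConv_pos (hv : 0 < v) (s : ℝ) (x : E) : 0 < gaussConv μ s v x :=
  integral_exp_pos (integrable_gaussKernel hv x s)

theorem isProbabilityMeasure_posterior (hv : 0 < v) (s : ℝ) (x : E) :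
    IsProbabilityMeasure (posterior μ s v x) :=
  isProbabilityMeasure_tilted (integrable_gaussKernel hv x s)

theorem memLp_inner_sub_posterior (hv : 0 < v) (s : ℝ) (x u : E) :
    MemLp (fun y => ⟪u, x - s • y⟫) 2 (posterior μ s v x) := by
  rw [memLp_two_iff_integrable_sq (Continuous.aestronglyMeasurable (by fun_prop)), posterior,
    integrable_tilted_iff (integrable_gaussKernel hv x s)]
  have hc : Continuous fun z : E => gaussKernel v z * ⟪u, z⟫ ^ 2 := by
    have := continuous_gaussKernel (E := E) (v := v)
    fun_prop
  refine integrable_comp_sub_smul hc (B := ‖u‖ ^ 2 * (2 * v)) (fun z => ?_) x s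
  rw [norm_mul, Real.norm_of_nonneg (gaussKernel_nonneg z), norm_pow]
  calc _ ≤ gaussKernel v z * (‖u‖ * ‖z‖) ^ 2 := by
        gcongr
        · exact gaussKernel_nonneg z
        · exact norm_inner_le_norm _ _
    _ = ‖u‖ ^ 2 * (‖z‖ ^ 2 * gaussKernel v z) := by ring
    _ ≤ _ := mul_le_mul_of_nonneg_left (norm_sq_mul_gaussKernel_le hv z) (sq_nonneg _)

theorem memLp_inner_posterior (hv : 0 < v) {s : ℝ} (hs : s ≠ 0) (x u : E) :
    MemLp (fun y => ⟪u, y⟫) 2 (posterior μ s v x) := by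
  have := isProbabilityMeasure_posterior (μ := μ) hv s x
  have h := ((memLp_const ⟪u, x⟫).sub (memLp_inner_sub_posterior (μ := μ) hv s x u)).const_mul s⁻¹
  refine h.ae_eq (ae_of_all _ fun y => ?_)
  simp only [Pi.sub_apply, inner_sub_right, real_inner_smul_right, sub_sub_cancel]
  exact inv_mul_cancel_left₀ hs _

variable [FiniteDimensional ℝ E]

theorem hasFDerivAt_gaussConv (hv : 0 < v) (s : ℝ) (x : E) :
    HasFDerivAt (gaussConv μ s v) (∫ y, gaussKernelDeriv v (x - s • y) ∂μ) x :=
  hasFDerivAt_integral_comp_sub_smul hasFDerivAt_gaussKernel continuous_gaussKernelDeriv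
    (norm_gaussKernel_le hv) (norm_gaussKernelDeriv_le hv) x s

theorem integral_gaussKernelDeriv_apply (hv : 0 < v) (s : ℝ) (x h : E) :
    (∫ y, gaussKernelDeriv v (x - s • y) ∂μ) h =
      -(gaussConv μ s v x / v) * ∫ y, ⟪h, x - s • y⟫ ∂(posterior μ s v x) := by
  have hF := (gaussConv_pos (μ := μ) hv s x).ne'
  rw [ContinuousLinearMap.integral_apply (integrable_comp_sub_smul continuous_gaussKernelDeriv
    (norm_gaussKernelDeriv_le hv) x s), integral_posterior]
  have : ∀ y, gaussKernelDeriv v (x - s • y) h =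
      -(1 / v) * (⟪h, x - s • y⟫ * gaussKernel v (x - s • y)) := fun y => by
    rw [gaussKernelDeriv, _root_.smul_apply, innerSL_apply_apply, smul_eq_mul,
      real_inner_comm]
    ring
  simp_rw [this]
  rw [integral_const_mul]
  field_simp

theorem hasFDerivAt_integral_inner_mul_gaussKernel (hv : 0 < v) (s : ℝ) (w x : E) :
    HasFDerivAt (fun x => ∫ y, ⟪w, x - s • y⟫ * gaussKernel v (x - s • y) ∂μ)
      (∫ y, innerGaussKernelDeriv v w (x - s • y) ∂μ) x :=
  hasFDerivAt_integral_comp_sub_smul (hasFDerivAt_inner_mul_gaussKernel w)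
    (continuous_innerGaussKernelDeriv w) (norm_inner_mul_gaussKernel_le hv w)
    (norm_innerGaussKernelDeriv_le hv w) x s

theorem integral_innerGaussKernelDeriv_apply (hv : 0 < v) (s : ℝ) (w x h : E) :
    (∫ y, innerGaussKernelDeriv v w (x - s • y) ∂μ) h =
      gaussConv μ s v x * (⟪w, h⟫ -
        (1 / v) * ∫ y, ⟪w, x - s • y⟫ * ⟪h, x - s • y⟫ ∂(posterior μ s v x)) := by
  have hF := (gaussConv_pos (μ := μ) hv s x).ne'
  have := isProbabilityMeasure_posterior (μ := μ) hv s x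
  have hint : Integrable (fun y => ⟪w, x - s • y⟫ * ⟪h, x - s • y⟫) (posterior μ s v x) :=
    (memLp_inner_sub_posterior hv s x w).integrable_mul (memLp_inner_sub_posterior hv s x h)
  have e : ⟪w, h⟫ - (1 / v) * ∫ y, ⟪w, x - s • y⟫ * ⟪h, x - s • y⟫ ∂(posterior μ s v x) =
      ∫ y, (⟪w, h⟫ - (1 / v) * (⟪w, x - s • y⟫ * ⟪h, x - s • y⟫)) ∂(posterior μ s v x) := by
    rw [integral_sub (integrable_const _) (hint.const_mul _), integral_const_mul]
    simp
  rw [e, integral_posterior, mul_div_cancel₀ _ hF, ContinuousLinearMap.integral_apply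
    (integrable_comp_sub_smul (continuous_innerGaussKernelDeriv w)
      (norm_innerGaussKernelDeriv_le hv w) x s)]
  refine integral_congr_ae (.of_forall fun y => ?_)
  simp only [innerGaussKernelDeriv, gaussKernelDeriv, _root_.add_apply,
    _root_.smul_apply, innerSL_apply_apply, smul_eq_mul]
  rw [real_inner_comm h]
  ring

/-- The derivative of the posterior mean along a line is a posterior covariance. -/
theorem hasDerivAt_integral_posterior (hv : 0 < v) {s : ℝ} (hs : s ≠ 0) (w x h : E) (τ : ℝ) :
    HasDerivAt (fun τ : ℝ => ∫ y, ⟪w, (x + τ • h) - s • y⟫ ∂(posterior μ s v (x + τ • h)))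
      (⟪w, h⟫ - s ^ 2 / v * ProbabilityTheory.covariance (fun y => ⟪w, y⟫) (fun y => ⟪h, y⟫)
        (posterior μ s v (x + τ • h))) τ := by
  have hline : HasDerivAt (fun τ : ℝ => x + τ • h) h τ := by
    simpa using ((hasDerivAt_id τ).smul_const h).const_add x
  have hF := (hasFDerivAt_gaussConv (μ := μ) hv s (x + τ • h)).comp_hasDerivAt τ hline
  have hG := (hasFDerivAt_integral_inner_mul_gaussKernel (μ := μ) hv s w
    (x + τ • h)).comp_hasDerivAt τ hline
  have hF0 := (gaussConv_pos (μ := μ) hv s (x + τ • h)).ne'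
  have hquot := hG.div hF hF0
  simp_rw [integral_posterior]
  refine hquot.congr_deriv ?_
  simp only [Function.comp_apply]
  rw [integral_gaussKernelDeriv_apply hv, integral_innerGaussKernelDeriv_apply hv]
  set p := x + τ • h
  have := isProbabilityMeasure_posterior (μ := μ) hv s p
  have hi (u : E) : Integrable (fun y => s * ⟪u, y⟫) (posterior μ s v p) :=
    ((memLp_inner_posterior hv hs p u).integrable (by norm_num)).const_mul s
  have hcov : ProbabilityTheory.covariance (fun y => ⟪w, p - s • y⟫) (fun y => ⟪h, p - s • y⟫)
      (posterior μ s v p) = s ^ 2 *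
      ProbabilityTheory.covariance (fun y => ⟪w, y⟫) (fun y => ⟪h, y⟫) (posterior μ s v p) := by
    simp only [inner_sub_right, real_inner_smul_right]
    rw [ProbabilityTheory.covariance_const_sub_left (hi w),
      ProbabilityTheory.covariance_const_sub_right (hi h),
      ProbabilityTheory.covariance_const_mul_left, ProbabilityTheory.covariance_const_mul_right]
    ring
  have hcov2 := ProbabilityTheory.covariance_eq_sub
    (memLp_inner_sub_posterior (μ := μ) hv s p w) (memLp_inner_sub_posterior (μ := μ) hv s p h)
  rw [hcov, integral_posterior s p (fun y => ⟪w, p - s • y⟫)] at hcov2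
  have e : s ^ 2 / v * ProbabilityTheory.covariance (fun y => ⟪w, y⟫) (fun y => ⟪h, y⟫)
      (posterior μ s v p) = (s ^ 2 * ProbabilityTheory.covariance (fun y => ⟪w, y⟫)
        (fun y => ⟪h, y⟫) (posterior μ s v p)) / v := by ring
  rw [e, hcov2]
  simp only [Pi.mul_apply]
  field_simp
  ring

end Posterior

section Score

theorem midpoint_add_norm_sq_div_le {E : Type*} [NormedAddCommGroup E] [InnerProductSpace ℝ E]
    {V W : E → ℝ} {α L : ℝ}
    (hVmid : ∀ x y, V ((2⁻¹ : ℝ) • (x + y)) ≤ (V x + V y) / 2 - α / 8 * ‖x - y‖ ^ 2)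
    (hW : ∀ x y, |W x - W y| ≤ L * ‖x - y‖) (s v : ℝ) (p x y : E) :
    V ((2⁻¹ : ℝ) • (x + y)) + W ((2⁻¹ : ℝ) • (x + y)) +
        ‖p - s • (2⁻¹ : ℝ) • (x + y)‖ ^ 2 / (2 * v) ≤
      ((V x + W x + ‖p - s • x‖ ^ 2 / (2 * v)) + (V y + W y + ‖p - s • y‖ ^ 2 / (2 * v))) / 2 -
        (α + s ^ 2 / v) / 8 * ‖x - y‖ ^ 2 + L / 2 * ‖x - y‖ := by
  set m := (2⁻¹ : ℝ) • (x + y) with hm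
  have hmx : ‖m - x‖ = 2⁻¹ * ‖x - y‖ := by
    rw [show m - x = (-2⁻¹ : ℝ) • (x - y) by rw [hm]; module, norm_smul]; norm_num
  have hmy : ‖m - y‖ = 2⁻¹ * ‖x - y‖ := by
    rw [show m - y = (2⁻¹ : ℝ) • (x - y) by rw [hm]; module, norm_smul]; norm_num
  have h1 := (le_abs_self _).trans (hW m x)
  have h2 := (le_abs_self _).trans (hW m y)
  rw [hmx] at h1
  rw [hmy] at h2
  have hq : ‖p - s • m‖ ^ 2 = (‖p - s • x‖ ^ 2 + ‖p - s • y‖ ^ 2) / 2 -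
      s ^ 2 / 4 * ‖x - y‖ ^ 2 := by
    have hpar := parallelogram_law_with_norm ℝ (p - s • x) (p - s • y)
    have e1 : ‖p - s • x + (p - s • y)‖ = 2 * ‖p - s • m‖ := by
      rw [show p - s • x + (p - s • y) = (2 : ℝ) • (p - s • m) by rw [hm]; module, norm_smul]
      norm_num
    have e2 : ‖p - s • x - (p - s • y)‖ ^ 2 = s ^ 2 * ‖x - y‖ ^ 2 := by
      rw [show p - s • x - (p - s • y) = (-s) • (x - y) by module, norm_smul, norm_neg,
        mul_pow, Real.norm_eq_abs, sq_abs]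
    rw [e1, e2] at hpar
    linarith
  rw [hq]
  have hV := hVmid x y
  rw [← hm] at hV
  have : ((‖p - s • x‖ ^ 2 + ‖p - s • y‖ ^ 2) / 2 - s ^ 2 / 4 * ‖x - y‖ ^ 2) / (2 * v) =
      (‖p - s • x‖ ^ 2 / (2 * v) + ‖p - s • y‖ ^ 2 / (2 * v)) / 2 -
        (s ^ 2 / v) / 8 * ‖x - y‖ ^ 2 := by ring
  rw [this]
  linear_combination hV + h1 / 2 + h2 / 2

theorem norm_sub_le_of_forall_inner_hasDerivAt {E : Type*} [NormedAddCommGroup E]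
    [InnerProductSpace ℝ E] {F : E → E} {K : ℝ} {D : E → E → E → ℝ}
    (hD : ∀ w x h : E, ∀ τ : ℝ, HasDerivAt (fun τ : ℝ => ⟪w, F (x + τ • h)⟫) (D w h (x + τ • h)) τ)
    (hK : ∀ w h p, |D w h p| ≤ K * ‖w‖ * ‖h‖) (x y : E) : ‖F x - F y‖ ≤ K * ‖x - y‖ := by
  have key := norm_image_sub_le_of_norm_deriv_le_segment_01'
    (f := fun τ : ℝ => ⟪F x - F y, F (y + τ • (x - y))⟫)
    (fun τ _ => (hD (F x - F y) y (x - y) τ).hasDerivWithinAt)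
    (fun τ _ => hK (F x - F y) (x - y) _)
  simp only [one_smul, zero_smul, add_zero, add_sub_cancel, ← inner_sub_right,
    real_inner_self_eq_norm_sq, norm_pow, norm_norm] at key
  rcases (norm_nonneg (F x - F y)).eq_or_lt with h0 | h0
  · have hnn := (abs_nonneg _).trans (hK (x - y) (x - y) 0)
    rcases (norm_nonneg (x - y)).eq_or_lt with h1 | h1
    · rw [← h0, ← h1, mul_zero]
    · rw [← h0]
      exact nonneg_of_mul_nonneg_left hnn h1
  · exact le_of_mul_le_mul_left (by linarith) h0

theorem inv_smul_withDensity_eq_tilted {E : Type*} [MeasurableSpace E] {μ : Measure E}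
    {f : E → ℝ} [NeZero μ]
    (hf : Integrable (fun x => exp (f x)) μ) :
    (ENNReal.ofReal (∫ x, exp (f x) ∂μ))⁻¹ • μ.withDensity (fun x => ENNReal.ofReal (exp (f x))) =
      μ.tilted f := by
  have hZ := integral_exp_pos hf
  rw [Measure.tilted, ← withDensity_smul' _ _ (by simpa using hZ)]
  congr 1
  ext x
  rw [Pi.smul_apply, smul_eq_mul, ENNReal.ofReal_div_of_pos hZ, mul_comm, div_eq_mul_inv]

variable {E : Type*} [NormedAddCommGroup E] [InnerProductSpace ℝ E] [FiniteDimensional ℝ E]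
  [MeasurableSpace E] [BorelSpace E]

theorem posterior_tilted {f : E → ℝ} (hf : Integrable fun y => exp (f y)) (s v : ℝ) (x : E) :
    posterior (volume.tilted f) s v x =
      volume.tilted fun y => -(-f y + ‖x - s • y‖ ^ 2 / (2 * v)) := by
  rw [posterior, tilted_tilted hf]
  congr 1
  ext y
  simp only [Pi.add_apply]
  ring

/-- The posterior variance in every direction is controlled by the strong convexity of the
potential and the Lipschitz constant of its perturbation. -/
theorem variance_posterior_le {d : ℕ} {V W : Euc d → ℝ} {α L : ℝ} (hα : 0 < α) (hVm : Measurable V)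
    (hWm : Measurable W) (hint : Integrable fun x => exp (-(V x + W x)))
    (hVmid : ∀ x y, V ((2⁻¹ : ℝ) • (x + y)) ≤ (V x + V y) / 2 - α / 8 * ‖x - y‖ ^ 2)
    (hW : ∀ x y, |W x - W y| ≤ L * ‖x - y‖) {s v : ℝ} (hv : 0 < v) (hs : s ≠ 0) (p u : Euc d)
    (hu : ‖u‖ = 1) :
    ProbabilityTheory.variance (fun y => ⟪u, y⟫)
        (posterior (volume.tilted fun y => -(V y + W y)) s v p) ≤
      40 / (α + s ^ 2 / v) + 32 * L ^ 2 / (α + s ^ 2 / v) ^ 2 := by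
  have := isProbabilityMeasure_tilted (μ := (volume : Measure (Euc d))) hint
  have hmem := memLp_inner_posterior (μ := volume.tilted fun y => -(V y + W y)) hv hs p u
  rw [posterior_tilted hint] at hmem ⊢
  simp only [neg_neg] at hmem ⊢
  refine variance_inner_tilted_le (by fun_prop) ?_ (by positivity)
    (midpoint_add_norm_sq_div_le hVmid hW s v p) hu hmem
  refine hint.mono' (Measurable.aestronglyMeasurable (by fun_prop)) (.of_forall fun y => ?_)
  rw [Real.norm_of_nonneg (exp_nonneg _)]
  refine exp_le_exp.2 (neg_le_neg ?_)
  exact le_add_of_nonneg_right (by positivity)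

theorem inner_gradient_log_gaussConv {μ : Measure E} [IsProbabilityMeasure μ] {c s v : ℝ}
    (hc : 0 < c) (hv : 0 < v) (x w : E) :
    ⟪w, gradient (fun z => log (c * gaussConv μ s v z)) x⟫ =
      -(1 / v) * ∫ y, ⟪w, x - s • y⟫ ∂(posterior μ s v x) := by
  have hpos := gaussConv_pos (μ := μ) hv s x
  have h := ((hasFDerivAt_gaussConv (μ := μ) hv s x).const_mul c).log (by positivity)
  rw [real_inner_comm, inner_gradient_left, h.fderiv]
  simp only [_root_.smul_apply, smul_eq_mul]
  rw [integral_gaussKernelDeriv_apply hv]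
  field_simp

theorem one_div_sub_one_add_mul_le {α L s v : ℝ} (hα : 0 < α) (hv : 0 < v) (hs : s ≠ 0) :
    (1 / v - 1) + s ^ 2 / v ^ 2 * (40 / (α + s ^ 2 / v) + 32 * L ^ 2 / (α + s ^ 2 / v) ^ 2) ≤
      73 * max 1 (L ^ 2 / α) / v := by
  set b := s ^ 2 / v with hb
  have hb0 : 0 < b := by positivity
  have e : s ^ 2 / v ^ 2 = b / v := by rw [hb]; field_simp
  have h1 : b / (α + b) ≤ 1 := (div_le_one (by positivity)).2 (by linarith)
  have h2 : b * L ^ 2 / (α + b) ^ 2 ≤ L ^ 2 / α := by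
    rw [div_le_div_iff₀ (by positivity) hα]
    have : b * α ≤ (α + b) ^ 2 := by nlinarith
    nlinarith [mul_le_mul_of_nonneg_left this (sq_nonneg L)]
  have e2 : (1 / v - 1) + s ^ 2 / v ^ 2 * (40 / (α + b) + 32 * L ^ 2 / (α + b) ^ 2) =
      (1 - v + 40 * (b / (α + b)) + 32 * (b * L ^ 2 / (α + b) ^ 2)) / v := by
    rw [e]; field_simp; ring
  rw [e2]
  refine div_le_div_of_nonneg_right ?_ hv.le
  linarith [le_max_left 1 (L ^ 2 / α), le_max_right 1 (L ^ 2 / α)]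

theorem norm_score_sub_le {d : ℕ} {V W : Euc d → ℝ} {α L : ℝ} (hα : 0 < α) (hVm : Measurable V)
    (hWm : Measurable W) (hint : Integrable fun x => exp (-(V x + W x)))
    (hVmid : ∀ x y, V ((2⁻¹ : ℝ) • (x + y)) ≤ (V x + V y) / 2 - α / 8 * ‖x - y‖ ^ 2)
    (hW : ∀ x y, |W x - W y| ≤ L * ‖x - y‖) {c s v : ℝ} (hc : 0 < c) (hv : 0 < v) (hs : s ≠ 0)
    (hsv : s ^ 2 = 1 - v) {F : Euc d → Euc d}
    (hF : ∀ x, F x = gradient (fun z =>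
      log (c * gaussConv (volume.tilted fun y => -(V y + W y)) s v z)) x + x) (x y : Euc d) :
    ‖F x - F y‖ ≤ 73 * max 1 (L ^ 2 / α) / v * ‖x - y‖ := by
  have := isProbabilityMeasure_tilted (μ := (volume : Measure (Euc d))) hint
  set μ := (volume : Measure (Euc d)).tilted fun y => -(V y + W y) with hμ
  refine norm_sub_le_of_forall_inner_hasDerivAt (D := fun w h p => -(1 / v) * (⟪w, h⟫ -
    s ^ 2 / v * ProbabilityTheory.covariance (fun y => ⟪w, y⟫) (fun y => ⟪h, y⟫)
      (posterior μ s v p)) + ⟪w, h⟫) (fun w x h τ => ?_) (fun w h p => ?_) x y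
  · simp only [hF, inner_add_right, inner_gradient_log_gaussConv hc hv]
    refine ((hasDerivAt_integral_posterior hv hs w x h τ).const_mul _).add ?_
    simpa [real_inner_smul_right] using ((hasDerivAt_id τ).mul_const ⟪w, h⟫).const_add ⟪w, x⟫
  · have := isProbabilityMeasure_posterior (μ := μ) hv s p
    have hcov := abs_covariance_inner_le (memLp_inner_posterior (μ := μ) hv hs p)
      (variance_posterior_le hα hVm hWm hint hVmid hW hv hs p) w h
    set cov := ProbabilityTheory.covariance (fun y => ⟪w, y⟫) (fun y => ⟪h, y⟫) (posterior μ s v p)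
    set K := 40 / (α + s ^ 2 / v) + 32 * L ^ 2 / (α + s ^ 2 / v) ^ 2 with hK
    have hv1 : 0 ≤ 1 / v - 1 := by
      have : 1 / v - 1 = s ^ 2 / v := by rw [hsv]; field_simp
      rw [this]; positivity
    calc |-(1 / v) * (⟪w, h⟫ - s ^ 2 / v * cov) + ⟪w, h⟫|
        = |-((1 / v - 1) * ⟪w, h⟫) + s ^ 2 / v ^ 2 * cov| := by congr 1; field_simp; ring
      _ ≤ (1 / v - 1) * |⟪w, h⟫| + s ^ 2 / v ^ 2 * |cov| := by
        refine (abs_add_le _ _).trans (le_of_eq ?_)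
        rw [abs_neg, abs_mul, abs_mul, abs_of_nonneg hv1,
          abs_of_nonneg (show 0 ≤ s ^ 2 / v ^ 2 by positivity)]
      _ ≤ (1 / v - 1) * (‖w‖ * ‖h‖) + s ^ 2 / v ^ 2 * (K * ‖w‖ * ‖h‖) :=
        add_le_add (mul_le_mul_of_nonneg_left (abs_real_inner_le_norm _ _) hv1)
          (mul_le_mul_of_nonneg_left hcov (by positivity))
      _ = ((1 / v - 1) + s ^ 2 / v ^ 2 * K) * (‖w‖ * ‖h‖) := by ring
      _ ≤ _ := by
        rw [mul_assoc]
        exact mul_le_mul_of_nonneg_right (one_div_sub_one_add_mul_le hα hv hs)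
          (by positivity)

end Score

/-- Lipschitz perturbations of strongly log-concave measures. There is a
universal constant `C` such that if `V` is `C²` and `α`-strongly convex (`∇²V ⪰ α I`), `W` is
`L`-Lipschitz, and `μ ∝ e^{−V−W}`, then for every `t > 0` the relative score
`x ↦ ∇log p_t(x) + x` is `C·max(1, L²/α)/(1−e^{−2t})`-Lipschitz. -/
theorem statement_10 :
    ∃ C : ℝ, 0 < C ∧
      ∀ (d : ℕ), 1 ≤ d →
        ∀ (α L : ℝ), 0 < α → 0 ≤ L →
          ∀ V W : Euc d → ℝ,
            ContDiff ℝ 2 V →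
            (∀ x u : Euc d, α * ‖u‖ ^ 2 ≤ ⟪(fderiv ℝ (fun z => gradient V z) x) u, u⟫) →
            (∀ x y : Euc d, |W x - W y| ≤ L * ‖x - y‖) →
            ∀ μ : Measure (Euc d),
              μ = (ENNReal.ofReal (∫ x, Real.exp (-(V x + W x))))⁻¹ •
                  volume.withDensity (fun x => ENNReal.ofReal (Real.exp (-(V x + W x)))) →
              ∀ t : ℝ, 0 < t →
                ∀ x y : Euc d,
                  ‖relScore d μ t x - relScore d μ t y‖ ≤
                    C * max 1 (L ^ 2 / α) / (1 - Real.exp (-2 * t)) * ‖x - y‖ := by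
  refine ⟨73, by norm_num, fun d _ α L hα hL V W hV hHess hW μ hμ t ht x y => ?_⟩
  have hWc : Continuous W := (LipschitzWith.of_dist_le_mul (K := L.toNNReal) fun x y => by
    rw [Real.coe_toNNReal L hL, dist_eq_norm, Real.norm_eq_abs, dist_eq_norm]
    exact hW x y).continuous
  have hint := integrable_exp_neg_add hα hV hHess hW hWc.measurable
  rw [inv_smul_withDensity_eq_tilted hint] at hμ
  have hv : 0 < 1 - exp (-2 * t) := sub_pos.2 (exp_lt_one_iff.2 (by linarith))
  refine norm_score_sub_le hα hV.continuous.measurable hWc.measurable hint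
    (midpoint_le_of_hessian hV hHess) hW
    (c := (2 * π * (1 - exp (-2 * t))) ^ (-(d : ℝ) / 2)) (s := exp (-t)) (by positivity) hv
    (exp_ne_zero _) ?_ (fun x => ?_) x y
  · rw [sub_sub_cancel, ← exp_nat_mul]
    congr 1
    push_cast
    ring
  · rw [relScore, hμ]
    rfl
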